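/- Let k be a field and H a commutative Hopf algebra over k with bijective antipode which is noetherian (in particular this holds when H is finite dimensional), semisimple (as an algebra) and cosemisimple (as a coalgebra). Then every left-right Yetter-Drinfeld module M over H is a direct sum, in the category of Yetter-Drinfeld modules, of a family of simple subobjects of M that are finitely generated as H-modules; hence the category of left-right Yetter-Drinfeld modules over H is semisimple. -/

import Mathlib

/-!
Common definitions for formalizing "Semisimplicity of the categories of
Yetter-Drinfeld modules and Long dimodules" (Caenepeel, Guédénon).
-/

open TensorProduct

noncomputable section
namespace YDPaper

section RingPart

variable (k H : Type) [CommRing k] [Ring H] [HopfAlgebra k H]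

/-- `ρ : M →ₗ[k] M ⊗[k] H` is a (coassociative, counital) right `H`-comodule
structure on `M`. -/
def IsComod {M : Type} [AddCommGroup M] [Module k M] (ρ : M →ₗ[k] M ⊗[k] H) : Prop :=
  (∀ m : M, (TensorProduct.rid k M)
      ((LinearMap.lTensor M (Coalgebra.counit (R := k) (A := H))) (ρ m)) = m) ∧
  (∀ m : M, (TensorProduct.assoc k M H H) ((LinearMap.rTensor H ρ) (ρ m)) =
      (LinearMap.lTensor M (Coalgebra.comul (R := k) (A := H))) (ρ m))

/-- The iterated comultiplication `h ↦ (h₁ ⊗ h₂) ⊗ h₃`. -/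
def Delta2 : H →ₗ[k] (H ⊗[k] H) ⊗[k] H :=
  (LinearMap.rTensor H (Coalgebra.comul (R := k) (A := H))).comp
    (Coalgebra.comul (R := k) (A := H))

/-- The Yetter-Drinfeld compatibility condition
`ρ(h • m) = h₂ • m₀ ⊗ h₃ m₁ S⁻¹(h₁)`, expressed via arbitrary Sweedler
decompositions of `Δ²(h)` and `ρ(m)` into finite sums of pure tensors. -/
def IsYDCompat (Sinv : H →ₗ[k] H) {M : Type} [AddCommGroup M] [Module k M] [Module H M]
    (ρ : M →ₗ[k] M ⊗[k] H) : Prop :=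
  ∀ (h : H) (m : M) (s t : Finset ℕ) (a b c : ℕ → H) (m₀ : ℕ → M) (m₁ : ℕ → H),
    (∑ i ∈ s, (a i ⊗ₜ[k] b i) ⊗ₜ[k] c i) = Delta2 k H h →
    (∑ j ∈ t, m₀ j ⊗ₜ[k] m₁ j) = ρ m →
    ρ (h • m) = ∑ i ∈ s, ∑ j ∈ t, (b i • m₀ j) ⊗ₜ[k] (c i * m₁ j * Sinv (a i))

/-- The `k`-linear map `m ↦ h • m`. -/
def smulMap {M : Type} [AddCommGroup M] [Module k M] [Module H M] [SMulCommClass H k M]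
    (h : H) : M →ₗ[k] M where
  toFun m := h • m
  map_add' := smul_add h
  map_smul' c m := (smul_comm h c m)

/-- The Long dimodule compatibility condition `ρ(h • m) = h • m₀ ⊗ m₁`. -/
def IsLongCompat {M : Type} [AddCommGroup M] [Module k M] [Module H M] [SMulCommClass H k M]
    (ρ : M →ₗ[k] M ⊗[k] H) : Prop :=
  ∀ (h : H) (m : M), ρ (h • m) = (LinearMap.rTensor H (smulMap k H h)) (ρ m)

/-- Morphisms in the categories of Yetter-Drinfeld modules and of Long dimodules:
`H`-linear and `H`-colinear maps. -/
def IsHom {A B : Type} [AddCommGroup A] [Module k A] [Module H A]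
    [AddCommGroup B] [Module k B] [Module H B]
    (ρA : A →ₗ[k] A ⊗[k] H) (ρB : B →ₗ[k] B ⊗[k] H) (f : A →ₗ[k] B) : Prop :=
  (∀ (h : H) (a : A), f (h • a) = h • f a) ∧
  ρB.comp f = (LinearMap.rTensor H f).comp ρA

/-- `H`-colinearity of a `k`-linear map between right `H`-comodules. -/
def IsColin {A B : Type} [AddCommGroup A] [Module k A]
    [AddCommGroup B] [Module k B]
    (ρA : A →ₗ[k] A ⊗[k] H) (ρB : B →ₗ[k] B ⊗[k] H) (f : A →ₗ[k] B) : Prop :=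
  ρB.comp f = (LinearMap.rTensor H f).comp ρA

/-- A bundled left-right Yetter-Drinfeld module over `H` (with chosen inverse `Sinv`
of the antipode). -/
structure YDCat (Sinv : H →ₗ[k] H) where
  M : Type
  [iAdd : AddCommGroup M]
  [iModk : Module k M]
  [iModH : Module H M]
  [iTower : IsScalarTower k H M]
  [iComm : SMulCommClass H k M]
  ρ : M →ₗ[k] M ⊗[k] H
  comod : IsComod k H ρ
  compat : IsYDCompat k H Sinv ρ

attribute [instance] YDCat.iAdd YDCat.iModk YDCat.iModH YDCat.iTower YDCat.iComm

/-- A bundled left-right Long dimodule over `H`. -/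
structure LongCat where
  M : Type
  [iAdd : AddCommGroup M]
  [iModk : Module k M]
  [iModH : Module H M]
  [iTower : IsScalarTower k H M]
  [iComm : SMulCommClass H k M]
  ρ : M →ₗ[k] M ⊗[k] H
  comod : IsComod k H ρ
  compat : IsLongCompat k H ρ

attribute [instance] LongCat.iAdd LongCat.iModk LongCat.iModH LongCat.iTower LongCat.iComm

/-- A bundled right `H`-comodule. -/
structure ComodCat where
  V : Type
  [iAdd : AddCommGroup V]
  [iModk : Module k V]
  ρ : V →ₗ[k] V ⊗[k] H
  comod : IsComod k H ρ

attribute [instance] ComodCat.iAdd ComodCat.iModk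

section Subobjects

variable {k H}
variable {M : Type} [AddCommGroup M] [Module k M] [Module H M] [IsScalarTower k H M]

/-- A subobject in the category of Yetter-Drinfeld modules (or Long dimodules):
an `H`-submodule which is stable under the coaction, i.e. `ρ(p) ⊆ p ⊗ H`. -/
def IsSubobject (ρ : M →ₗ[k] M ⊗[k] H) (p : Submodule H M) : Prop :=
  ∀ m ∈ p, ρ m ∈ LinearMap.range (LinearMap.rTensor H (p.restrictScalars k).subtype)

/-- A simple subobject: a nonzero coaction-stable `H`-submodule with no proper
nonzero coaction-stable `H`-submodules. -/
def IsSimpleSubobject (ρ : M →ₗ[k] M ⊗[k] H) (p : Submodule H M) : Prop :=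
  IsSubobject ρ p ∧ p ≠ ⊥ ∧
    ∀ q : Submodule H M, IsSubobject ρ q → q ≤ p → q = ⊥ ∨ q = p

/-- `M` is the (internal) direct sum of a family of simple subobjects which are
finitely generated as `H`-modules. -/
def IsSemisimpleObj (ρ : M →ₗ[k] M ⊗[k] H) : Prop :=
  ∃ (ι : Type) (S : ι → Submodule H M),
    (∀ i, IsSimpleSubobject ρ (S i) ∧ (S i).FG) ∧
    iSupIndep S ∧ (⨆ i, S i) = ⊤

end Subobjects

section Subcomodules

variable {k H}
variable {V : Type} [AddCommGroup V] [Module k V]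

/-- A subcomodule: a `k`-submodule stable under the coaction. -/
def IsSubcomod (ρ : V →ₗ[k] V ⊗[k] H) (p : Submodule k V) : Prop :=
  ∀ v ∈ p, ρ v ∈ LinearMap.range (LinearMap.rTensor H p.subtype)

/-- A simple subcomodule. -/
def IsSimpleSubcomod (ρ : V →ₗ[k] V ⊗[k] H) (p : Submodule k V) : Prop :=
  IsSubcomod ρ p ∧ p ≠ ⊥ ∧
    ∀ q : Submodule k V, IsSubcomod ρ q → q ≤ p → q = ⊥ ∨ q = p

/-- A comodule is semisimple if it is the internal direct sum of a family of simple
subcomodules. -/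
def IsSemisimpleComod (ρ : V →ₗ[k] V ⊗[k] H) : Prop :=
  ∃ (ι : Type) (S : ι → Submodule k V),
    (∀ i, IsSimpleSubcomod ρ (S i)) ∧ iSupIndep S ∧ (⨆ i, S i) = ⊤

end Subcomodules

/-- `H` is cosemisimple: every right `H`-comodule is a direct sum of simple
subcomodules. -/
def Cosemisimple : Prop := ∀ C : ComodCat k H, IsSemisimpleComod C.ρ

section Coinv

variable {k H}
variable {A B : Type} [AddCommGroup A] [Module k A] [AddCommGroup B] [Module k B]

/-- The coinvariants `M^{co H} = { m | ρ m = m ⊗ 1 }` of a right `H`-comodule. -/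
def coinv (ρ : A →ₗ[k] A ⊗[k] H) : Submodule k A :=
  LinearMap.ker (ρ - (TensorProduct.mk k A H).flip 1)

lemma mem_coinv {ρ : A →ₗ[k] A ⊗[k] H} {a : A} :
    a ∈ coinv ρ ↔ ρ a = a ⊗ₜ[k] (1 : H) := by
  simp [coinv, LinearMap.mem_ker, sub_eq_zero]

/-- The map induced on coinvariants by an `H`-colinear map. -/
def coinvMap {ρA : A →ₗ[k] A ⊗[k] H} {ρB : B →ₗ[k] B ⊗[k] H} (f : A →ₗ[k] B)
    (hf : IsColin k H ρA ρB f) : ↥(coinv ρA) →ₗ[k] ↥(coinv ρB) :=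
  f.restrict (fun a ha => by
    have h1 : ρA a = a ⊗ₜ[k] (1 : H) := mem_coinv.1 ha
    have h2 : ρB (f a) = (LinearMap.rTensor H f) (ρA a) := by
      have := congrArg (fun (g : A →ₗ[k] B ⊗[k] H) => g a) hf
      simpa using this
    rw [mem_coinv, h2, h1, LinearMap.rTensor_tmul])

end Coinv

/-- Exactness of the coinvariants functor on the category of Yetter-Drinfeld
modules. -/
def CoinvExactYD (Sinv : H →ₗ[k] H) : Prop :=
  ∀ (A B C : YDCat k H Sinv) (f : A.M →ₗ[k] B.M) (g : B.M →ₗ[k] C.M)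
    (hf : IsHom k H A.ρ B.ρ f) (hg : IsHom k H B.ρ C.ρ g),
    Function.Injective f → Function.Surjective g →
    LinearMap.range f = LinearMap.ker g →
    Function.Injective (coinvMap f hf.2) ∧
    LinearMap.range (coinvMap f hf.2) = LinearMap.ker (coinvMap g hg.2) ∧
    Function.Surjective (coinvMap g hg.2)

/-- Exactness of the coinvariants functor on the category of right `H`-comodules. -/
def CoinvExactComod : Prop :=
  ∀ (A B C : ComodCat k H) (f : A.V →ₗ[k] B.V) (g : B.V →ₗ[k] C.V)
    (hf : IsColin k H A.ρ B.ρ f) (hg : IsColin k H B.ρ C.ρ g),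
    Function.Injective f → Function.Surjective g →
    LinearMap.range f = LinearMap.ker g →
    Function.Injective (coinvMap f hf) ∧
    LinearMap.range (coinvMap f hf) = LinearMap.ker (coinvMap g hg) ∧
    Function.Surjective (coinvMap g hg)

section Eval

variable {k H}
variable {M N : Type} [AddCommGroup M] [Module k M] [Module H M]
  [IsScalarTower k H M] [SMulCommClass H k M]
  [AddCommGroup N] [Module k N] [Module H N] [IsScalarTower k H N] [SMulCommClass H k N]

/-- Evaluation at `m` of `H`-linear maps, as a `k`-linear map. -/
def evalAtH (m : M) : (M →ₗ[H] N) →ₗ[k] N where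
  toFun f := f m
  map_add' _ _ := rfl
  map_smul' _ _ := rfl

/-- Evaluation at `m` of `k`-linear maps, as a `k`-linear map. -/
def evalAtK {V : Type} [AddCommGroup V] [Module k V] (v : V) :
    (V →ₗ[k] N) →ₗ[k] N where
  toFun f := f v
  map_add' _ _ := rfl
  map_smul' _ _ := rfl

/-- Contraction `N ⊗ H → N` along a functional `φ : H → k`. -/
def contract (φ : H →ₗ[k] k) : N ⊗[k] H →ₗ[k] N :=
  (TensorProduct.rid k N).toLinearMap.comp (LinearMap.lTensor N φ)

/-- Post-composition with an `H`-linear map, as a `k`-linear map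
`Hom_H(X, M) → Hom_H(X, N)`; here `X` is the (implicit) source. -/
def postcompH {X : Type} [AddCommGroup X] [Module k X] [Module H X]
    [IsScalarTower k H X] [SMulCommClass H k X]
    (f : M →ₗ[k] N) (hf : ∀ (h : H) (m : M), f (h • m) = h • f m) :
    (X →ₗ[H] M) →ₗ[k] (X →ₗ[H] N) where
  toFun φ :=
    { toFun := fun x => f (φ x)
      map_add' := fun x y => by simp
      map_smul' := fun h x => by simp [hf] }
  map_add' φ ψ := by ext x; simp
  map_smul' c φ := by ext x; simp

end Eval

/-- Condition (†) for the category of Yetter-Drinfeld modules: for every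
Yetter-Drinfeld module `X` which is finitely generated as a left `H`-module,
the functor `Hom_H(X, -)` is exact on the category of Yetter-Drinfeld modules. -/
def DaggerYD (Sinv : H →ₗ[k] H) : Prop :=
  ∀ X : YDCat k H Sinv, Module.Finite H X.M →
  ∀ (A B C : YDCat k H Sinv) (f : A.M →ₗ[k] B.M) (g : B.M →ₗ[k] C.M)
    (hf : IsHom k H A.ρ B.ρ f) (hg : IsHom k H B.ρ C.ρ g),
    Function.Injective f → Function.Surjective g →
    LinearMap.range f = LinearMap.ker g →
    Function.Injective (postcompH (X := X.M) f hf.1) ∧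
    LinearMap.range (postcompH (X := X.M) f hf.1) =
      LinearMap.ker (postcompH (X := X.M) g hg.1) ∧
    Function.Surjective (postcompH (X := X.M) g hg.1)

/-- Condition (†) for the category of Long dimodules. -/
def DaggerLong : Prop :=
  ∀ X : LongCat k H, Module.Finite H X.M →
  ∀ (A B C : LongCat k H) (f : A.M →ₗ[k] B.M) (g : B.M →ₗ[k] C.M)
    (hf : IsHom k H A.ρ B.ρ f) (hg : IsHom k H B.ρ C.ρ g),
    Function.Injective f → Function.Surjective g →
    LinearMap.range f = LinearMap.ker g →
    Function.Injective (postcompH (X := X.M) f hf.1) ∧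
    LinearMap.range (postcompH (X := X.M) f hf.1) =
      LinearMap.ker (postcompH (X := X.M) g hg.1) ∧
    Function.Surjective (postcompH (X := X.M) g hg.1)

/-- Projective object in the category of Yetter-Drinfeld modules. -/
def IsProjectiveYD (Sinv : H →ₗ[k] H) (P : YDCat k H Sinv) : Prop :=
  ∀ (A B : YDCat k H Sinv) (g : A.M →ₗ[k] B.M) (f : P.M →ₗ[k] B.M),
    IsHom k H A.ρ B.ρ g → Function.Surjective g → IsHom k H P.ρ B.ρ f →
    ∃ l : P.M →ₗ[k] A.M, IsHom k H P.ρ A.ρ l ∧ g.comp l = f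

/-- Projective object in the category of Long dimodules. -/
def IsProjectiveLong (P : LongCat k H) : Prop :=
  ∀ (A B : LongCat k H) (g : A.M →ₗ[k] B.M) (f : P.M →ₗ[k] B.M),
    IsHom k H A.ρ B.ρ g → Function.Surjective g → IsHom k H P.ρ B.ρ f →
    ∃ l : P.M →ₗ[k] A.M, IsHom k H P.ρ A.ρ l ∧ g.comp l = f

/-- Injective object in the category of Yetter-Drinfeld modules. -/
def IsInjectiveYD (Sinv : H →ₗ[k] H) (I : YDCat k H Sinv) : Prop :=
  ∀ (A B : YDCat k H Sinv) (ι : A.M →ₗ[k] B.M) (f : A.M →ₗ[k] I.M),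
    IsHom k H A.ρ B.ρ ι → Function.Injective ι → IsHom k H A.ρ I.ρ f →
    ∃ g : B.M →ₗ[k] I.M, IsHom k H B.ρ I.ρ g ∧ g.comp ι = f

/-- Projective object in the category of right `H`-comodules. -/
def IsProjectiveComod (P : ComodCat k H) : Prop :=
  ∀ (A B : ComodCat k H) (g : A.V →ₗ[k] B.V) (f : P.V →ₗ[k] B.V),
    IsColin k H A.ρ B.ρ g → Function.Surjective g → IsColin k H P.ρ B.ρ f →
    ∃ l : P.V →ₗ[k] A.V, IsColin k H P.ρ A.ρ l ∧ g.comp l = f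

section HomLemmas

variable {k H}
variable {A B C : Type} [AddCommGroup A] [Module k A] [Module H A]
  [AddCommGroup B] [Module k B] [Module H B]
  [AddCommGroup C] [Module k C] [Module H C]

lemma IsHom.comp' {ρA : A →ₗ[k] A ⊗[k] H} {ρB : B →ₗ[k] B ⊗[k] H} {ρC : C →ₗ[k] C ⊗[k] H}
    {f : A →ₗ[k] B} {g : B →ₗ[k] C}
    (hf : IsHom k H ρA ρB f) (hg : IsHom k H ρB ρC g) :
    IsHom k H ρA ρC (g.comp f) := by
  refine ⟨fun h a => by simp [LinearMap.comp_apply, hf.1, hg.1], ?_⟩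
  calc ρC.comp (g.comp f) = (ρC.comp g).comp f := by rw [LinearMap.comp_assoc]
    _ = ((LinearMap.rTensor H g).comp ρB).comp f := by rw [hg.2]
    _ = (LinearMap.rTensor H g).comp (ρB.comp f) := by rw [LinearMap.comp_assoc]
    _ = (LinearMap.rTensor H g).comp ((LinearMap.rTensor H f).comp ρA) := by rw [hf.2]
    _ = ((LinearMap.rTensor H g).comp (LinearMap.rTensor H f)).comp ρA := by
          rw [LinearMap.comp_assoc]
    _ = (LinearMap.rTensor H (g.comp f)).comp ρA := by rw [LinearMap.rTensor_comp]

end HomLemmas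

section HomYD

variable {k H}
variable (Sinv : H →ₗ[k] H)

/-- The `k`-module of morphisms of Yetter-Drinfeld modules `Hom_H^H(A, B)`, as a
submodule of the `k`-linear maps. -/
def homYD (A B : YDCat k H Sinv) : Submodule k (A.M →ₗ[k] B.M) where
  carrier := {f | IsHom k H A.ρ B.ρ f}
  add_mem' := by
    rintro f g ⟨hf1, hf2⟩ ⟨hg1, hg2⟩
    refine ⟨fun h a => by simp [hf1, hg1, smul_add], ?_⟩
    rw [LinearMap.comp_add, LinearMap.rTensor_add, LinearMap.add_comp, hf2, hg2]
  zero_mem' := by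
    refine ⟨fun h a => by simp, ?_⟩
    rw [LinearMap.comp_zero, LinearMap.rTensor_zero, LinearMap.zero_comp]
  smul_mem' := by
    rintro c f ⟨hf1, hf2⟩
    refine ⟨fun h a => by
      rw [LinearMap.smul_apply, LinearMap.smul_apply, hf1, smul_comm], ?_⟩
    rw [LinearMap.comp_smul, LinearMap.rTensor_smul, LinearMap.smul_comp, hf2]

/-- Post-composition with a morphism of Yetter-Drinfeld modules, as a `k`-linear map
between morphism spaces. -/
def postcompYD {X B C : YDCat k H Sinv}
    (g : B.M →ₗ[k] C.M) (hg : IsHom k H B.ρ C.ρ g) :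
    ↥(homYD Sinv X B) →ₗ[k] ↥(homYD Sinv X C) where
  toFun f := ⟨g.comp f.1, IsHom.comp' f.2 hg⟩
  map_add' f g' := by ext x; simp
  map_smul' c f := by ext x; simp

/-- An injective resolution `0 → X → I⁰ → I¹ → ⋯` in the category of
Yetter-Drinfeld modules. -/
structure IsInjRes (X : YDCat k H Sinv) (I : ℕ → YDCat k H Sinv)
    (ε : X.M →ₗ[k] (I 0).M) (d : ∀ n, (I n).M →ₗ[k] (I (n + 1)).M) : Prop where
  eps_hom : IsHom k H X.ρ (I 0).ρ ε
  d_hom : ∀ n, IsHom k H (I n).ρ (I (n + 1)).ρ (d n)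
  inj : ∀ n, IsInjectiveYD k H Sinv (I n)
  mono : Function.Injective ε
  exact0 : LinearMap.range ε = LinearMap.ker (d 0)
  exact : ∀ n, LinearMap.range (d n) = LinearMap.ker (d (n + 1))

/-- A projective resolution `⋯ → P₁ → P₀ → X → 0` in the category of
Yetter-Drinfeld modules. -/
structure IsProjRes (X : YDCat k H Sinv) (P : ℕ → YDCat k H Sinv)
    (ε : (P 0).M →ₗ[k] X.M) (d : ∀ n, (P (n + 1)).M →ₗ[k] (P n).M) : Prop where
  eps_hom : IsHom k H (P 0).ρ X.ρ ε
  d_hom : ∀ n, IsHom k H (P (n + 1)).ρ (P n).ρ (d n)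
  proj : ∀ n, IsProjectiveYD k H Sinv (P n)
  epi : Function.Surjective ε
  exact0 : LinearMap.range (d 0) = LinearMap.ker ε
  exact : ∀ n, LinearMap.range (d (n + 1)) = LinearMap.ker (d n)

/-- The projective dimension of `X` in the category of Yetter-Drinfeld modules is
at most `n`. -/
def pdimLE (X : YDCat k H Sinv) (n : ℕ) : Prop :=
  ∃ (P : ℕ → YDCat k H Sinv) (ε : (P 0).M →ₗ[k] X.M)
    (d : ∀ m, (P (m + 1)).M →ₗ[k] (P m).M),
    IsProjRes Sinv X P ε d ∧ ∀ i, n < i → Subsingleton (P i).M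

/-- The injective dimension of `X` in the category of Yetter-Drinfeld modules is
at most `n`. -/
def injdimLE (X : YDCat k H Sinv) (n : ℕ) : Prop :=
  ∃ (I : ℕ → YDCat k H Sinv) (ε : X.M →ₗ[k] (I 0).M)
    (d : ∀ m, (I m).M →ₗ[k] (I (m + 1)).M),
    IsInjRes Sinv X I ε d ∧ ∀ i, n < i → Subsingleton (I i).M

/-- The complex `Hom(X, I⁰) → Hom(X, I¹) → ⋯` of morphism spaces induced by a
cochain of Yetter-Drinfeld modules. -/
def homCx (X : YDCat k H Sinv) (I : ℕ → YDCat k H Sinv)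
    (d : ∀ n, (I n).M →ₗ[k] (I (n + 1)).M)
    (hd : ∀ n, IsHom k H (I n).ρ (I (n + 1)).ρ (d n)) (n : ℕ) :
    ↥(homYD Sinv X (I n)) →ₗ[k] ↥(homYD Sinv X (I (n + 1))) :=
  postcompYD Sinv (d n) (hd n)

/-- Coboundaries of the induced complex. -/
def boundaries (X : YDCat k H Sinv) (I : ℕ → YDCat k H Sinv)
    (d : ∀ n, (I n).M →ₗ[k] (I (n + 1)).M)
    (hd : ∀ n, IsHom k H (I n).ρ (I (n + 1)).ρ (d n)) :
    ∀ i, Submodule k ↥(homYD Sinv X (I i))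
  | 0 => ⊥
  | (i + 1) => LinearMap.range (homCx Sinv X I d hd i)

/-- The `i`-th cohomology (cocycles modulo coboundaries) of the complex
`Hom(X, I⁰) → Hom(X, I¹) → ⋯`; when `I` is an injective resolution of `Y`, this is
`Ext^i(X, Y)`, the `i`-th right derived functor of `Hom_H^H(X, -)`, in the category
of Yetter-Drinfeld modules. -/
abbrev cohomology (X : YDCat k H Sinv) (I : ℕ → YDCat k H Sinv)
    (d : ∀ n, (I n).M →ₗ[k] (I (n + 1)).M)
    (hd : ∀ n, IsHom k H (I n).ρ (I (n + 1)).ρ (d n)) (i : ℕ) : Type :=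
  ↥(Submodule.map (boundaries Sinv X I d hd i).mkQ
      (LinearMap.ker (homCx Sinv X I d hd i)))

end HomYD

section CharProps

variable {k H}
variable (Sinv : H →ₗ[k] H)

/-- Characterizing property of the coaction on `Hom_H(A, B)` for Yetter-Drinfeld
modules `A`, `B`: it is determined by `f₀(m) ⊗ f₁ = f(m₀)₀ ⊗ f(m₀)₁ S(m₁)`. -/
def HomCoactChar (A B : YDCat k H Sinv)
    (ρQ : (A.M →ₗ[H] B.M) →ₗ[k] (A.M →ₗ[H] B.M) ⊗[k] H) : Prop :=
  ∀ (f : A.M →ₗ[H] B.M) (m : A.M) (t : Finset ℕ) (m₀ : ℕ → A.M) (m₁ : ℕ → H),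
    (∑ j ∈ t, m₀ j ⊗ₜ[k] m₁ j) = A.ρ m →
    (LinearMap.rTensor H (evalAtH (N := B.M) m)) (ρQ f) =
      ∑ j ∈ t, (LinearMap.lTensor B.M
          (LinearMap.mulRight k (HopfAlgebra.antipode (R := k) (A := H) (m₁ j))))
        (B.ρ (f (m₀ j)))

/-- Characterizing property of the coaction on `Hom_k(V, B)` for a comodule `V` and
a Yetter-Drinfeld module `B`: `g₀(v) ⊗ g₁ = g(v₀)₀ ⊗ g(v₀)₁ S(v₁)`. -/
def HomKCoactChar (V : ComodCat k H) (B : YDCat k H Sinv)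
    (ρ' : (V.V →ₗ[k] B.M) →ₗ[k] (V.V →ₗ[k] B.M) ⊗[k] H) : Prop :=
  ∀ (g : V.V →ₗ[k] B.M) (v : V.V) (t : Finset ℕ) (v₀ : ℕ → V.V) (v₁ : ℕ → H),
    (∑ j ∈ t, v₀ j ⊗ₜ[k] v₁ j) = V.ρ v →
    (LinearMap.rTensor H (evalAtK (N := B.M) v)) (ρ' g) =
      ∑ j ∈ t, (LinearMap.lTensor B.M
          (LinearMap.mulRight k (HopfAlgebra.antipode (R := k) (A := H) (v₁ j))))
        (B.ρ (g (v₀ j)))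

/-- Characterizing property of the Yetter-Drinfeld coaction on `H ⊗ V`:
`ρ(h ⊗ v) = h₂ ⊗ v₀ ⊗ h₃ v₁ S⁻¹(h₁)`. -/
def HTensorYDChar (V : ComodCat k H)
    (ρT : (H ⊗[k] V.V) →ₗ[k] (H ⊗[k] V.V) ⊗[k] H) : Prop :=
  ∀ (h : H) (v : V.V) (s t : Finset ℕ) (a b c : ℕ → H) (v₀ : ℕ → V.V) (v₁ : ℕ → H),
    (∑ i ∈ s, (a i ⊗ₜ[k] b i) ⊗ₜ[k] c i) = Delta2 k H h →
    (∑ j ∈ t, v₀ j ⊗ₜ[k] v₁ j) = V.ρ v →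
    ρT (h ⊗ₜ[k] v) =
      ∑ i ∈ s, ∑ j ∈ t, (b i ⊗ₜ[k] v₀ j) ⊗ₜ[k] (c i * v₁ j * Sinv (a i))

/-- Characterizing property of the Long dimodule coaction on `H ⊗ V`:
`ρ(h ⊗ v) = h ⊗ v₀ ⊗ v₁`. -/
def HTensorLongChar (V : ComodCat k H)
    (ρT : (H ⊗[k] V.V) →ₗ[k] (H ⊗[k] V.V) ⊗[k] H) : Prop :=
  ∀ (h : H) (v : V.V) (t : Finset ℕ) (v₀ : ℕ → V.V) (v₁ : ℕ → H),
    (∑ j ∈ t, v₀ j ⊗ₜ[k] v₁ j) = V.ρ v →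
    ρT (h ⊗ₜ[k] v) = ∑ j ∈ t, (h ⊗ₜ[k] v₀ j) ⊗ₜ[k] v₁ j

end CharProps

end RingPart

section CommPart

variable {k H : Type} [CommRing k] [CommRing H] [HopfAlgebra k H] (Sinv : H →ₗ[k] H)

/-- Characterizing property of the Yetter-Drinfeld coaction on `M ⊗_H N`:
`ρ(m ⊗ n) = m₀ ⊗ n₀ ⊗ n₁ m₁` (for `H` commutative). -/
def TensorCoactChar (A B : YDCat k H Sinv)
    (ρT : (A.M ⊗[H] B.M) →ₗ[k] (A.M ⊗[H] B.M) ⊗[k] H) : Prop :=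
  ∀ (m : A.M) (n : B.M) (s t : Finset ℕ) (m₀ : ℕ → A.M) (m₁ : ℕ → H)
    (n₀ : ℕ → B.M) (n₁ : ℕ → H),
    (∑ i ∈ s, m₀ i ⊗ₜ[k] m₁ i) = A.ρ m →
    (∑ j ∈ t, n₀ j ⊗ₜ[k] n₁ j) = B.ρ n →
    ρT (m ⊗ₜ[H] n) =
      ∑ i ∈ s, ∑ j ∈ t, (m₀ i ⊗ₜ[H] n₀ j) ⊗ₜ[k] (n₁ j * m₁ i)

/-- Restriction along `v ↦ 1 ⊗ v`, i.e. the canonical map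
`Hom_H(H ⊗ V, N) → Hom_k(V, N)`, `f ↦ (v ↦ f(1 ⊗ v))`. -/
def resUnitMap (V : Type) [AddCommGroup V] [Module k V] (N : Type) [AddCommGroup N]
    [Module k N] [Module H N] [IsScalarTower k H N] [SMulCommClass H k N] :
    ((H ⊗[k] V) →ₗ[H] N) →ₗ[k] (V →ₗ[k] N) where
  toFun f := (f.restrictScalars k).comp ((TensorProduct.mk k H V) 1)
  map_add' f g := by ext v; rfl
  map_smul' c f := by ext v; rfl

end CommPart

section Helpers

variable {k H : Type} [Field k] [CommRing H] [HopfAlgebra k H]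
variable {M : Type} [AddCommGroup M] [Module k M]

/-- Contraction of the right factor against a functional. -/
def ctr (M : Type) [AddCommGroup M] [Module k M] (φ : H →ₗ[k] k) : M ⊗[k] H →ₗ[k] M :=
  (TensorProduct.rid k M).toLinearMap.comp (LinearMap.lTensor M φ)

lemma ctr_tmul (φ : H →ₗ[k] k) (m : M) (h : H) : ctr M φ (m ⊗ₜ[k] h) = φ h • m := by
  simp [ctr]

lemma ctr_rTensor {N : Type} [AddCommGroup N] [Module k N] (φ : H →ₗ[k] k) (f : M →ₗ[k] N)
    (x : M ⊗[k] H) : ctr N φ (LinearMap.rTensor H f x) = f (ctr M φ x) := by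
  induction x using TensorProduct.induction_on with
  | zero => simp
  | tmul m h => simp [ctr_tmul]
  | add x y hx hy => simp [hx, hy]

lemma eq_zero_of_ctr (x : M ⊗[k] H) (hx : ∀ φ : H →ₗ[k] k, ctr M φ x = 0) : x = 0 := by
  classical
  let b := Module.Basis.ofVectorSpace k H
  apply (TensorProduct.equivFinsuppOfBasisRight (M := M) b).injective
  rw [map_zero]
  ext i
  have key : ∀ y : M ⊗[k] H, TensorProduct.equivFinsuppOfBasisRight (M := M) b y i =
      ctr M (b.coord i) y := by
    intro y
    induction y using TensorProduct.induction_on with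
    | zero => simp
    | tmul m h => simp [ctr_tmul]
    | add x y hx hy => simp [hx, hy]
  rw [key, hx]; rfl

lemma mem_range_iff_ctr (p : Submodule k M) (x : M ⊗[k] H) :
    x ∈ LinearMap.range (LinearMap.rTensor H p.subtype) ↔ ∀ φ : H →ₗ[k] k, ctr M φ x ∈ p := by
  constructor
  · rintro ⟨y, rfl⟩ φ
    rw [ctr_rTensor]
    exact (ctr p φ y).2
  · intro h
    have hex := rTensor_exact H (f := p.subtype) (g := p.mkQ)
      (LinearMap.exact_subtype_mkQ p) p.mkQ_surjective
    refine (hex x).1 (eq_zero_of_ctr _ fun φ => ?_)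
    rw [ctr_rTensor]
    simpa using h φ

/-- Composite of the coaction with contraction: the action of the dual algebra. -/
def dact (ρ : M →ₗ[k] M ⊗[k] H) (φ : H →ₗ[k] k) : M →ₗ[k] M := (ctr M φ).comp ρ

lemma isSubcomod_iff (ρ : M →ₗ[k] M ⊗[k] H) (p : Submodule k M) :
    IsSubcomod ρ p ↔ ∀ φ : H →ₗ[k] k, ∀ m ∈ p, dact ρ φ m ∈ p := by
  unfold IsSubcomod
  simp only [mem_range_iff_ctr]
  exact ⟨fun h φ m hm => h m hm φ, fun h m hm φ => h φ m hm⟩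

lemma isSubobject_iff [Module H M] [IsScalarTower k H M] (ρ : M →ₗ[k] M ⊗[k] H)
    (p : Submodule H M) :
    IsSubobject ρ p ↔ ∀ φ : H →ₗ[k] k, ∀ m ∈ p, dact ρ φ m ∈ p := by
  unfold IsSubobject
  simp only [mem_range_iff_ctr]
  exact ⟨fun h φ m hm => h m hm φ, fun h m hm φ => h φ m hm⟩

/-- A subspace stable under a set of operators is a submodule over the algebra they generate. -/
def adjSub (T : Set (Module.End k M)) (p : Submodule k M) (hp : ∀ t ∈ T, ∀ m ∈ p, t m ∈ p) :
    Submodule (Algebra.adjoin k T) M :=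
  { p with
    smul_mem' := by
      rintro ⟨r, hr⟩ m hm
      change r m ∈ p
      induction hr using Algebra.adjoin_induction generalizing m with
      | mem t ht => exact hp t ht m hm
      | algebraMap c => simpa using p.smul_mem c hm
      | add x y _ _ hx hy => exact p.add_mem (hx hm) (hy hm)
      | mul x y _ _ hx hy => exact hx (hy hm) }

lemma mem_adjSub {T : Set (Module.End k M)} {p : Submodule k M}
    {hp : ∀ t ∈ T, ∀ m ∈ p, t m ∈ p} {m : M} : m ∈ adjSub T p hp ↔ m ∈ p := Iff.rfl

lemma adj_stable {T : Set (Module.End k M)} (q : Submodule (Algebra.adjoin k T) M)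
    {t : Module.End k M} (ht : t ∈ T) {m : M} (hm : m ∈ q) : t m ∈ q :=
  q.smul_mem ⟨t, Algebra.subset_adjoin ht⟩ hm

/-- The extension of the coaction to `M ⊗ H`. -/
def rhoHat (ρ : M →ₗ[k] M ⊗[k] H) : M ⊗[k] H →ₗ[k] M ⊗[k] H :=
  (LinearMap.lTensor M (LinearMap.mul' k H)).comp
    ((TensorProduct.assoc k M H H).toLinearMap.comp (LinearMap.rTensor H ρ))

/-- The inverse of `rhoHat`. -/
def sigma (ρ : M →ₗ[k] M ⊗[k] H) : M ⊗[k] H →ₗ[k] M ⊗[k] H :=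
  (rhoHat ((LinearMap.lTensor M (HopfAlgebra.antipode k (A := H))).comp ρ))

lemma rhoHat_tmul (ρ : M →ₗ[k] M ⊗[k] H) (m : M) (g : H) :
    rhoHat ρ (m ⊗ₜ g) = LinearMap.lTensor M (LinearMap.mulRight k g) (ρ m) := by
  simp only [rhoHat, LinearMap.comp_apply, LinearMap.rTensor_tmul]
  generalize ρ m = w
  induction w using TensorProduct.induction_on with
  | zero => simp
  | tmul m h => simp
  | add x y hx hy => simp only [TensorProduct.add_tmul, map_add, hx, hy]

lemma rhoHat_mulRight (ρ : M →ₗ[k] M ⊗[k] H) (g : H) (x : M ⊗[k] H) :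
    rhoHat ρ (LinearMap.lTensor M (LinearMap.mulRight k g) x) =
      LinearMap.lTensor M (LinearMap.mulRight k g) (rhoHat ρ x) := by
  induction x using TensorProduct.induction_on with
  | zero => simp
  | tmul m h =>
    simp only [LinearMap.lTensor_tmul, rhoHat_tmul]
    generalize ρ m = w
    induction w using TensorProduct.induction_on with
    | zero => simp
    | add x y hx hy => simp only [map_add, hx, hy]
    | tmul n c => simp [mul_assoc]
  | add x y hx hy => simp only [map_add, hx, hy]

lemma counit_aux {ρ : M →ₗ[k] M ⊗[k] H} (hρ : IsComod k H ρ) (m : M) :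
    LinearMap.lTensor M ((Algebra.linearMap k H) ∘ₗ Coalgebra.counit) (ρ m) = m ⊗ₜ 1 := by
  have h1 := hρ.1 m
  conv_rhs => rw [← h1]
  generalize ρ m = w
  induction w using TensorProduct.induction_on with
  | zero => simp
  | tmul m h => simp [Algebra.algebraMap_eq_smul_one, TensorProduct.smul_tmul]
  | add x y hx hy => simp only [map_add, hx, hy, TensorProduct.add_tmul]

lemma sigma_rho {ρ : M →ₗ[k] M ⊗[k] H} (hρ : IsComod k H ρ) (m : M) :
    sigma ρ (ρ m) = m ⊗ₜ 1 := by
  rw [← counit_aux hρ m, ← HopfAlgebra.mul_antipode_rTensor_comul]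
  simp only [LinearMap.lTensor_comp, LinearMap.comp_apply, ← hρ.2 m]
  simp only [sigma, rhoHat, LinearMap.comp_apply, LinearMap.rTensor_comp, LinearEquiv.coe_coe]
  congr 1
  generalize LinearMap.rTensor H ρ (ρ m) = w
  induction w using TensorProduct.induction_on with
  | zero => simp
  | add x y hx hy => simp only [map_add, hx, hy]
  | tmul v h =>
  induction v using TensorProduct.induction_on with
  | zero => simp
  | add x y hx hy => simp only [map_add, hx, hy, TensorProduct.add_tmul]
  | tmul v h => simp

lemma rhoHat_antipode {ρ : M →ₗ[k] M ⊗[k] H} (hρ : IsComod k H ρ) (m : M) :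
    rhoHat ρ (LinearMap.lTensor M (HopfAlgebra.antipode k (A := H)) (ρ m)) = m ⊗ₜ 1 := by
  rw [← counit_aux hρ m, ← HopfAlgebra.mul_antipode_lTensor_comul]
  simp only [LinearMap.lTensor_comp, LinearMap.comp_apply, ← hρ.2 m]
  simp only [rhoHat, LinearMap.comp_apply, LinearEquiv.coe_coe]
  congr 1
  generalize ρ m = w
  induction w using TensorProduct.induction_on with
  | zero => simp
  | add x y hx hy => simp only [map_add, hx, hy]
  | tmul v h =>
  simp only [LinearMap.lTensor_tmul, LinearMap.rTensor_tmul]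
  generalize ρ v = w
  induction w using TensorProduct.induction_on with
  | zero => simp
  | add x y hx hy => simp only [map_add, hx, hy, TensorProduct.add_tmul]
  | tmul v h => simp

lemma sigma_rhoHat {ρ : M →ₗ[k] M ⊗[k] H} (hρ : IsComod k H ρ) (x : M ⊗[k] H) :
    sigma ρ (rhoHat ρ x) = x := by
  induction x using TensorProduct.induction_on with
  | zero => simp
  | add x y hx hy => simp only [map_add, hx, hy]
  | tmul m g =>
    rw [rhoHat_tmul, sigma, rhoHat_mulRight, ← sigma, sigma_rho hρ]
    simp

lemma rhoHat_sigma {ρ : M →ₗ[k] M ⊗[k] H} (hρ : IsComod k H ρ) (x : M ⊗[k] H) :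
    rhoHat ρ (sigma ρ x) = x := by
  induction x using TensorProduct.induction_on with
  | zero => simp
  | add x y hx hy => simp only [map_add, hx, hy]
  | tmul m g =>
    rw [sigma, rhoHat_tmul, rhoHat_mulRight, LinearMap.comp_apply, rhoHat_antipode hρ]
    simp

/-- The operator `n ⊗ (a ⊗ b) ↦ (n₀ ⊗ a) ⊗ n₁ b`. -/
def r13 (ρ : M →ₗ[k] M ⊗[k] H) : M ⊗[k] (H ⊗[k] H) →ₗ[k] (M ⊗[k] H) ⊗[k] H :=
  (TensorProduct.rightComm k M H H).toLinearMap ∘ₗ (LinearMap.rTensor H (rhoHat ρ)) ∘ₗ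
    (TensorProduct.rightComm k M H H).toLinearMap ∘ₗ (TensorProduct.assoc k M H H).symm.toLinearMap

lemma r13_tmul (ρ : M →ₗ[k] M ⊗[k] H) (m : M) (a b : H) :
    r13 ρ (m ⊗ₜ (a ⊗ₜ b)) = TensorProduct.rightComm k M H H
      ((LinearMap.lTensor M (LinearMap.mulRight k b) (ρ m)) ⊗ₜ a) := by
  simp [r13, rhoHat_tmul]

lemma comul_rhoHat {ρ : M →ₗ[k] M ⊗[k] H} (hρ : IsComod k H ρ) (y : M ⊗[k] H) :
    (TensorProduct.assoc k M H H).symm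
      (LinearMap.lTensor M (Coalgebra.comul (R := k) (A := H)) (rhoHat ρ y)) =
    LinearMap.rTensor H (rhoHat ρ)
      (r13 ρ (LinearMap.lTensor M (Coalgebra.comul (R := k) (A := H)) y)) := by
  induction y using TensorProduct.induction_on with
  | zero => simp
  | add x y hx hy => simp only [map_add, hx, hy]
  | tmul m g =>
  have h1 : LinearMap.lTensor M (Coalgebra.comul (R := k) (A := H)) (rhoHat ρ (m ⊗ₜ g)) =
      LinearMap.lTensor M (LinearMap.mulRight k (Coalgebra.comul (R := k) g))
        ((TensorProduct.assoc k M H H) ((LinearMap.rTensor H ρ) (ρ m))) := by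
    rw [hρ.2, rhoHat_tmul]
    generalize ρ m = w
    induction w using TensorProduct.induction_on with
    | zero => simp
    | add x y hx hy => simp only [map_add, hx, hy]
    | tmul n c => simp
  rw [h1, LinearMap.lTensor_tmul]
  generalize (Coalgebra.comul (R := k) g) = t
  induction t using TensorProduct.induction_on with
  | zero => simp
  | add x y hx hy =>
    rw [TensorProduct.tmul_add, map_add, map_add, ← hx, ← hy, ← map_add]
    congr 1
    rw [← LinearMap.add_apply, ← LinearMap.lTensor_add]
    congr 2
    ext <;> simp [mul_add]
  | tmul a b =>
  rw [r13_tmul]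
  generalize ρ m = w
  induction w using TensorProduct.induction_on with
  | zero => simp
  | add x y hx hy => simp only [map_add, hx, hy, TensorProduct.add_tmul]
  | tmul n c =>
  simp only [LinearMap.lTensor_tmul, LinearMap.rTensor_tmul, TensorProduct.rightComm_tmul,
    rhoHat_tmul]
  generalize ρ n = w
  induction w using TensorProduct.induction_on with
  | zero => simp
  | add x y hx hy => simp only [map_add, hx, hy, TensorProduct.add_tmul]
  | tmul n c => simp

lemma ctr_r13 {ρ : M →ₗ[k] M ⊗[k] H} (l : H →ₗ[k] k)
    (hl : ∀ g : H, TensorProduct.lid k H (LinearMap.rTensor H l (Coalgebra.comul (R := k) g)) =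
      l g • (1 : H)) (y : M ⊗[k] H) :
    LinearMap.rTensor H (ctr M l)
      (r13 ρ (LinearMap.lTensor M (Coalgebra.comul (R := k) (A := H)) y)) = ρ (ctr M l y) := by
  induction y using TensorProduct.induction_on with
  | zero => simp
  | add x y hx hy => simp only [map_add, hx, hy]
  | tmul m g =>
  have h1 : ∀ t : H ⊗[k] H, LinearMap.rTensor H (ctr M l) (r13 ρ (m ⊗ₜ t)) =
      LinearMap.lTensor M (LinearMap.mulRight k
        (TensorProduct.lid k H (LinearMap.rTensor H l t))) (ρ m) := by
    intro t
    induction t using TensorProduct.induction_on with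
    | zero => simp
    | add x y hx hy =>
      rw [TensorProduct.tmul_add, map_add, map_add, hx, hy]
      rw [← LinearMap.add_apply, ← LinearMap.lTensor_add]
      congr 2
      ext; simp [mul_add]
    | tmul a b =>
    rw [r13_tmul]
    generalize ρ m = w
    induction w using TensorProduct.induction_on with
    | zero => simp
    | add x y hx hy => simp only [map_add, hx, hy, TensorProduct.add_tmul]
    | tmul n c => simp [ctr_tmul, TensorProduct.smul_tmul]
  rw [LinearMap.lTensor_tmul, h1, hl, ctr_tmul, map_smul]
  generalize ρ m = w
  induction w using TensorProduct.induction_on with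
  | zero => simp
  | add x y hx hy => simp only [map_add, hx, hy, smul_add]
  | tmul n c => simp

/-- The averaged operator. -/
def avg (ρ : M →ₗ[k] M ⊗[k] H) (l : H →ₗ[k] k) (p : M →ₗ[k] M) : M →ₗ[k] M :=
  (ctr M l) ∘ₗ (sigma ρ) ∘ₗ (LinearMap.rTensor H p) ∘ₗ ρ

lemma avg_colin {ρ : M →ₗ[k] M ⊗[k] H} (hρ : IsComod k H ρ) (l : H →ₗ[k] k)
    (hl : ∀ g : H, TensorProduct.lid k H (LinearMap.rTensor H l (Coalgebra.comul (R := k) g)) =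
      l g • (1 : H)) (p : M →ₗ[k] M) (m : M) :
    ρ (avg ρ l p m) = LinearMap.rTensor H (avg ρ l p) (ρ m) := by
  set y := sigma ρ (LinearMap.rTensor H p (ρ m)) with hy
  have h0 : avg ρ l p m = ctr M l y := rfl
  have h1 : LinearMap.rTensor H (sigma ρ ∘ₗ (LinearMap.rTensor H p) ∘ₗ ρ) (ρ m) =
      r13 ρ (LinearMap.lTensor M (Coalgebra.comul (R := k) (A := H)) y) := by
    have hinj : Function.Injective (LinearMap.rTensor H (rhoHat ρ)) := by
      have : Function.LeftInverse (LinearMap.rTensor H (sigma ρ))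
          (LinearMap.rTensor H (rhoHat ρ)) := by
        intro x
        rw [← LinearMap.comp_apply, ← LinearMap.rTensor_comp]
        have : sigma ρ ∘ₗ rhoHat ρ = LinearMap.id := LinearMap.ext (sigma_rhoHat hρ)
        rw [this]; simp
      exact this.injective
    apply hinj
    rw [← comul_rhoHat hρ, hy, rhoHat_sigma hρ, ← LinearMap.comp_apply, ← LinearMap.rTensor_comp,
      ← LinearMap.comp_assoc]
    have : rhoHat ρ ∘ₗ sigma ρ = LinearMap.id := LinearMap.ext (rhoHat_sigma hρ)
    rw [this, LinearMap.id_comp]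
    have h2 : LinearMap.lTensor M (Coalgebra.comul (R := k) (A := H))
        (LinearMap.rTensor H p (ρ m)) = LinearMap.rTensor (H ⊗[k] H) p
          ((TensorProduct.assoc k M H H) ((LinearMap.rTensor H ρ) (ρ m))) := by
      rw [hρ.2]
      generalize ρ m = w
      induction w using TensorProduct.induction_on with
      | zero => simp
      | add x y hx hy => simp only [map_add, hx, hy]
      | tmul n c => simp
    rw [h2, LinearMap.rTensor_comp, LinearMap.comp_apply]
    generalize LinearMap.rTensor H ρ (ρ m) = w
    induction w using TensorProduct.induction_on with
    | zero => simp
    | add x y hx hy => simp only [map_add, hx, hy]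
    | tmul v h =>
    induction v using TensorProduct.induction_on with
    | zero => simp
    | add x y hx hy => simp only [map_add, hx, hy, TensorProduct.add_tmul]
    | tmul v h => simp
  rw [h0, ← ctr_r13 l hl, ← h1, ← LinearMap.comp_apply, ← LinearMap.rTensor_comp]
  rfl

end Helpers

section Helpers2

variable {k H : Type} [Field k] [CommRing H] [HopfAlgebra k H]
variable {M : Type} [AddCommGroup M] [Module k M]

lemma exists_sum_range {A X : Type} [AddCommGroup A] [Nonempty X] (f : X → A) {a : A}
    (ha : a ∈ AddSubmonoid.closure (Set.range f)) :
    ∃ (n : ℕ) (x : ℕ → X), ∑ i ∈ Finset.range n, f (x i) = a := by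
  induction ha using AddSubmonoid.closure_induction with
  | mem a h => obtain ⟨x, rfl⟩ := h; exact ⟨1, fun _ => x, by simp⟩
  | zero => exact ⟨0, fun _ => Classical.arbitrary X, by simp⟩
  | add a b _ _ ha hb =>
    obtain ⟨n, x, rfl⟩ := ha
    obtain ⟨m, y, rfl⟩ := hb
    refine ⟨n + m, fun i => if i < n then x i else y (i - n), ?_⟩
    rw [Finset.sum_range_add]
    congr 1
    · refine Finset.sum_congr rfl fun i hi => ?_
      simp only [if_pos (Finset.mem_range.1 hi)]
    · refine Finset.sum_congr rfl fun i hi => ?_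
      simp

lemma exists_decomp2 (x : M ⊗[k] H) :
    ∃ (n : ℕ) (a : ℕ → M) (b : ℕ → H), ∑ i ∈ Finset.range n, a i ⊗ₜ[k] b i = x := by
  obtain ⟨n, y, hy⟩ := exists_sum_range (X := M × H) (fun z => z.1 ⊗ₜ[k] z.2) (a := x) (by
    induction x using TensorProduct.induction_on with
    | zero => exact zero_mem _
    | add x y hx hy => exact add_mem hx hy
    | tmul m h => exact AddSubmonoid.subset_closure ⟨(m, h), rfl⟩)
  exact ⟨n, fun i => (y i).1, fun i => (y i).2, hy⟩

lemma exists_decomp3 (x : (H ⊗[k] H) ⊗[k] H) :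
    ∃ (n : ℕ) (a b c : ℕ → H), ∑ i ∈ Finset.range n, (a i ⊗ₜ[k] b i) ⊗ₜ[k] c i = x := by
  obtain ⟨n, y, hy⟩ := exists_sum_range (X := H × H × H)
    (fun z => (z.1 ⊗ₜ[k] z.2.1) ⊗ₜ[k] z.2.2) (a := x) (by
    induction x using TensorProduct.induction_on with
    | zero => exact zero_mem _
    | add x y hx hy => exact add_mem hx hy
    | tmul m h =>
      induction m using TensorProduct.induction_on with
      | zero => rw [TensorProduct.zero_tmul]; exact zero_mem _
      | add x y hx hy => rw [TensorProduct.add_tmul]; exact add_mem hx hy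
      | tmul a b => exact AddSubmonoid.subset_closure ⟨(a, b, h), rfl⟩)
  exact ⟨n, fun i => (y i).1, fun i => (y i).2.1, fun i => (y i).2.2, hy⟩

lemma dact_dact {ρ : M →ₗ[k] M ⊗[k] H} (hρ : IsComod k H ρ) (φ ψ : H →ₗ[k] k) :
    ∃ χ : H →ₗ[k] k, ∀ m, dact ρ ψ (dact ρ φ m) = dact ρ χ m := by
  refine ⟨(TensorProduct.lid k k).toLinearMap ∘ₗ (TensorProduct.map ψ φ) ∘ₗ Coalgebra.comul,
    fun m => ?_⟩
  have h1 : dact ρ ψ (dact ρ φ m) = ctr M ((TensorProduct.lid k k).toLinearMap ∘ₗ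
      (TensorProduct.map ψ φ)) ((TensorProduct.assoc k M H H) ((LinearMap.rTensor H ρ) (ρ m))) := by
    simp only [dact, LinearMap.comp_apply]
    generalize ρ m = w
    induction w using TensorProduct.induction_on with
    | zero => simp
    | add x y hx hy => simp only [map_add, hx, hy]
    | tmul m g =>
      simp only [LinearMap.rTensor_tmul, ctr_tmul, map_smul]
      generalize ρ m = w
      induction w using TensorProduct.induction_on with
      | zero => simp
      | add x y hx hy => simp only [map_add, hx, hy, TensorProduct.add_tmul, smul_add]
      | tmul m g' => simp [ctr, smul_smul, mul_comm]
  rw [h1, hρ.2]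
  simp [dact, ctr, LinearMap.lTensor_comp]

lemma exists_subcomod_compl {ρ : M →ₗ[k] M ⊗[k] H} (hρ : IsSemisimpleComod ρ)
    (p : Submodule k M) (hp : ∀ φ : H →ₗ[k] k, ∀ m ∈ p, dact ρ φ m ∈ p) :
    ∃ C : Submodule k M, (∀ φ : H →ₗ[k] k, ∀ m ∈ C, dact ρ φ m ∈ C) ∧ IsCompl p C := by
  obtain ⟨ι, S, hS, -, hsup⟩ := hρ
  let T : Set (Module.End k M) := Set.range (dact ρ)
  let R := Algebra.adjoin k T
  have hst : ∀ i, ∀ t ∈ T, ∀ m ∈ S i, t m ∈ S i := by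
    rintro i _ ⟨φ, rfl⟩ m hm
    exact (isSubcomod_iff ρ (S i)).1 (hS i).1 φ m hm
  let S' : ι → Submodule R M := fun i => adjSub T (S i) (hst i)
  have hsimple : ∀ i, IsSimpleModule R (S' i) := by
    intro i
    rw [isSimpleModule_iff_isAtom]
    refine ⟨fun h => (hS i).2.1 ?_, fun q hq => ?_⟩
    · rw [eq_bot_iff]
      intro x hx
      have : x ∈ S' i := hx
      rw [h] at this
      exact this
    · have hle : q.restrictScalars k ≤ S i := fun x hx => hq.le hx
      rcases (hS i).2.2 (q.restrictScalars k) ((isSubcomod_iff _ _).2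
        fun φ m hm => adj_stable q ⟨φ, rfl⟩ hm) hle with h | h
      · rw [eq_bot_iff]
        intro x hx
        have : x ∈ q.restrictScalars k := hx
        rw [h] at this
        exact this
      · exfalso
        refine hq.not_ge fun x hx => ?_
        have : x ∈ S i := hx
        rw [← h] at this
        exact this
  have htop : ⨆ i, S' i = ⊤ := by
    rw [eq_top_iff]
    intro x _
    have h1 : (⨆ i, S i) ≤ (⨆ i, S' i).restrictScalars k :=
      iSup_le fun i x hx => Submodule.mem_iSup_of_mem (p := S') i hx
    rw [hsup] at h1
    exact h1 Submodule.mem_top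
  have hsemi : IsSemisimpleModule R M :=
    isSemisimpleModule_of_isSemisimpleModule_submodule' (p := S')
      (fun i => by have := hsimple i; infer_instance) htop
  let K : Submodule R M := adjSub T p (by
    rintro _ ⟨φ, rfl⟩ m hm
    exact hp φ m hm)
  obtain ⟨C, hC⟩ := exists_isCompl K
  refine ⟨C.restrictScalars k, fun φ m hm => adj_stable C ⟨φ, rfl⟩ hm, ?_⟩
  constructor
  · rw [Submodule.disjoint_def]
    intro x hx hx'
    exact Submodule.disjoint_def.1 hC.1 x hx hx'
  · rw [codisjoint_iff, eq_top_iff]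
    intro x _
    have : x ∈ K ⊔ C := by rw [hC.sup_eq_top]; trivial
    obtain ⟨a, ha, b, hb, rfl⟩ := Submodule.mem_sup.1 this
    exact Submodule.add_mem_sup ha hb

lemma exists_integral (hcoss : Cosemisimple k H) :
    ∃ l : H →ₗ[k] k, l 1 = 1 ∧
    ∀ g : H, TensorProduct.lid k H (LinearMap.rTensor H l (Coalgebra.comul (R := k) g)) =
      l g • (1 : H) := by
  let Δ : H →ₗ[k] H ⊗[k] H := Coalgebra.comul
  have hΔ : IsComod k H Δ := ⟨fun m => by simp [Δ], fun m => by simp [Δ]⟩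
  have hss : IsSemisimpleComod Δ := hcoss ⟨H, Δ, hΔ⟩
  obtain ⟨C, hst, hC'⟩ := exists_subcomod_compl hss (Submodule.span k {(1 : H)}) (by
    intro φ m hm
    obtain ⟨c, rfl⟩ := Submodule.mem_span_singleton.1 hm
    simp only [map_smul]
    refine Submodule.smul_mem _ _ ?_
    have : dact Δ φ 1 = φ 1 • 1 := by
      simp [dact, Δ, Algebra.TensorProduct.one_def, ctr_tmul]
    rw [this]
    exact Submodule.smul_mem _ _ (Submodule.mem_span_singleton_self _))
  let l : H →ₗ[k] k := Coalgebra.counit ∘ₗ (Submodule.span k {(1 : H)}).subtype ∘ₗ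
    Submodule.projectionOnto _ _ hC'
  have hl1 : l 1 = 1 := by
    have := Submodule.projectionOnto_apply_left hC' ⟨1, Submodule.mem_span_singleton_self _⟩
    simp only [l, LinearMap.comp_apply]
    simp only at this
    rw [this]; simp
  have hlC : ∀ x ∈ C, l x = 0 := by
    intro x hx
    have : Submodule.projectionOnto _ _ hC' x = 0 :=
      (Submodule.projectionOnto_apply_eq_zero_iff hC').2 hx
    simp only [l, LinearMap.comp_apply, this, map_zero]
  refine ⟨l, hl1, fun g => ?_⟩
  have hg : g ∈ (Submodule.span k {(1 : H)}) ⊔ C := by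
    rw [hC'.sup_eq_top]; trivial
  obtain ⟨a, ha, b, hb, rfl⟩ := Submodule.mem_sup.1 hg
  obtain ⟨c, rfl⟩ := Submodule.mem_span_singleton.1 ha
  have hb0 : TensorProduct.lid k H (LinearMap.rTensor H l (Coalgebra.comul (R := k) b)) = 0 := by
    refine (Module.forall_dual_apply_eq_zero_iff k _).1 fun φ => ?_
    have h1 : l (dact Δ φ b) = 0 := hlC _ (hst φ b hb)
    rw [← h1]
    simp only [dact, LinearMap.comp_apply, Δ]
    generalize (Coalgebra.comul (R := k) b) = w
    induction w using TensorProduct.induction_on with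
    | zero => simp
    | add x y hx hy => simp only [map_add, hx, hy]
    | tmul m g => simp [ctr_tmul, mul_comm]
  simp only [map_add, map_smul, hb0, hlC b hb, hl1]
  simp [Algebra.TensorProduct.one_def, hl1]

variable [Module H M] [IsScalarTower k H M] [SMulCommClass H k M]

/-- The operator `m ⊗ g ↦ ∑ bᵢ m ⊗ g dᵢ`. -/
def dop (n : ℕ) (b d : ℕ → H) : M ⊗[k] H →ₗ[k] M ⊗[k] H :=
  ∑ i ∈ Finset.range n, TensorProduct.map (smulMap k H (b i)) (LinearMap.mulRight k (d i))

lemma dop_tmul (n : ℕ) (b d : ℕ → H) (m : M) (g : H) :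
    dop (k := k) n b d (m ⊗ₜ g) = ∑ i ∈ Finset.range n, (b i • m) ⊗ₜ[k] (g * d i) := by
  simp [dop, smulMap]

lemma exists_dop {Sinv : H →ₗ[k] H} {ρ : M →ₗ[k] M ⊗[k] H} (hc : IsYDCompat k H Sinv ρ) (h : H) :
    ∃ (n : ℕ) (b d : ℕ → H), ∀ m, ρ (h • m) = dop n b d (ρ m) := by
  obtain ⟨n, a, b, c, habc⟩ := exists_decomp3 (k := k) (Delta2 k H h)
  refine ⟨n, b, fun i => c i * Sinv (a i), fun m => ?_⟩
  obtain ⟨n', m₀, m₁, hm⟩ := exists_decomp2 (ρ m)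
  rw [hc h m _ _ a b c m₀ m₁ habc hm, ← hm, map_sum, Finset.sum_comm]
  refine Finset.sum_congr rfl fun j _ => ?_
  rw [dop_tmul]
  refine Finset.sum_congr rfl fun i _ => ?_
  congr 1
  ring

lemma avg_smul {Sinv : H →ₗ[k] H} {ρ : M →ₗ[k] M ⊗[k] H} (hρ : IsComod k H ρ)
    (hc : IsYDCompat k H Sinv ρ) (l : H →ₗ[k] k) (p : M →ₗ[k] M)
    (hp : ∀ (h : H) (m : M), p (h • m) = h • p m) (h : H) (m : M) :
    avg ρ l p (h • m) = h • avg ρ l p m := by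
  obtain ⟨n, b, d, hd⟩ := exists_dop hc h
  have h1 : ∀ y : M ⊗[k] H, dop n b d (rhoHat ρ y) =
      rhoHat ρ (LinearMap.rTensor H (smulMap k H h) y) := by
    intro y
    induction y using TensorProduct.induction_on with
    | zero => simp
    | add x y hx hy => simp only [map_add, hx, hy]
    | tmul m g =>
      rw [LinearMap.rTensor_tmul, rhoHat_tmul, rhoHat_tmul]
      change _ = LinearMap.lTensor M (LinearMap.mulRight k g) (ρ (h • m))
      rw [hd]
      generalize ρ m = w
      induction w using TensorProduct.induction_on with
      | zero => simp
      | add x y hx hy => simp only [map_add, hx, hy]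
      | tmul m g' =>
        simp only [LinearMap.lTensor_tmul, dop_tmul, map_sum, LinearMap.mulRight_apply]
        refine Finset.sum_congr rfl fun i _ => ?_
        congr 1; ring
  have h2 : ∀ y : M ⊗[k] H, LinearMap.rTensor H p (dop n b d y) =
      dop n b d (LinearMap.rTensor H p y) := by
    intro y
    induction y using TensorProduct.induction_on with
    | zero => simp
    | add x y hx hy => simp only [map_add, hx, hy]
    | tmul m g => simp [dop_tmul, hp]
  simp only [avg, LinearMap.comp_apply]
  rw [hd, h2]
  generalize LinearMap.rTensor H p (ρ m) = z
  have h3 : sigma ρ (dop n b d z) = LinearMap.rTensor H (smulMap k H h) (sigma ρ z) := by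
    conv_lhs => rw [← rhoHat_sigma hρ z]
    rw [h1, sigma_rhoHat hρ]
  rw [h3, ctr_rTensor]
  rfl

lemma exists_fg_subobject {Sinv : H →ₗ[k] H} {ρ : M →ₗ[k] M ⊗[k] H} (hρ : IsComod k H ρ)
    (hc : IsYDCompat k H Sinv ρ) (hn : IsNoetherianRing H) (m : M) :
    ∃ p : Submodule H M, p.FG ∧ m ∈ p ∧ ∀ φ : H →ₗ[k] k, ∀ x ∈ p, dact ρ φ x ∈ p := by
  let p : Submodule H M := Submodule.span H (Set.range fun φ : H →ₗ[k] k => dact ρ φ m)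
  refine ⟨p, ?_, ?_, ?_⟩
  · obtain ⟨n, a, b, hab⟩ := exists_decomp2 (ρ m)
    let q : Submodule H M := Submodule.span H (a '' (Finset.range n : Set ℕ))
    have hq : q.FG := Submodule.fg_span ((Finset.finite_toSet _).image _)
    have : Module.Finite H q := Module.Finite.iff_fg.2 hq
    have hNo : IsNoetherian H q := isNoetherian_of_isNoetherianRing_of_finite H q
    have hpq : p ≤ q := by
      refine Submodule.span_le.2 ?_
      rintro _ ⟨φ, rfl⟩
      simp only [dact, LinearMap.comp_apply, ← hab, map_sum, ctr_tmul]
      refine sum_mem fun i hi => ?_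
      rw [← algebraMap_smul H]
      exact q.smul_mem _ (Submodule.subset_span ⟨i, hi, rfl⟩)
    exact isNoetherian_submodule.1 hNo p hpq
  · refine Submodule.subset_span ⟨Coalgebra.counit, ?_⟩
    exact hρ.1 m
  · intro φ x hx
    induction hx using Submodule.span_induction generalizing φ with
    | mem x hx =>
      obtain ⟨ψ, rfl⟩ := hx
      obtain ⟨χ, hχ⟩ := dact_dact hρ ψ φ
      exact Submodule.subset_span ⟨χ, (hχ m).symm⟩
    | zero => simp
    | add x y _ _ hx hy => rw [map_add]; exact p.add_mem (hx φ) (hy φ)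
    | smul h x _ hx =>
      obtain ⟨n, b, d, hd⟩ := exists_dop hc h
      have : dact ρ φ (h • x) = ∑ i ∈ Finset.range n,
          b i • dact ρ (φ ∘ₗ LinearMap.mulRight k (d i)) x := by
        simp only [dact, LinearMap.comp_apply, hd]
        generalize ρ x = w
        induction w using TensorProduct.induction_on with
        | zero => simp
        | add x y hx hy => simp only [map_add, hx, hy, smul_add, Finset.sum_add_distrib]
        | tmul m g => 
          simp only [dop_tmul, map_sum, ctr_tmul, LinearMap.comp_apply, LinearMap.mulRight_apply]
          exact Finset.sum_congr rfl fun i _ => smul_comm _ _ _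
      rw [this]
      exact sum_mem fun i _ => p.smul_mem _ (hx _)

lemma exists_compl {Sinv : H →ₗ[k] H} {ρ : M →ₗ[k] M ⊗[k] H} (hρ : IsComod k H ρ)
    (hc : IsYDCompat k H Sinv ρ) (hss : IsSemisimpleRing H) (l : H →ₗ[k] k) (hl1 : l 1 = 1)
    (hl : ∀ g : H, TensorProduct.lid k H (LinearMap.rTensor H l (Coalgebra.comul (R := k) g)) =
      l g • (1 : H)) (N : Submodule H M) (hN : IsSubobject ρ N) :
    ∃ C : Submodule H M, (∀ φ : H →ₗ[k] k, ∀ x ∈ C, dact ρ φ x ∈ C) ∧ IsCompl N C := by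
  obtain ⟨C₀, hC₀⟩ := exists_isCompl N
  let p₀ : M →ₗ[H] M := N.subtype ∘ₗ N.projectionOnto C₀ hC₀
  have hp₀ : ∀ x ∈ N, p₀ x = x := fun x hx => by
    simpa [p₀] using congrArg Subtype.val (Submodule.projectionOnto_apply_left hC₀ ⟨x, hx⟩)
  have hp₁ : ∀ x, p₀ x ∈ N := fun x => (N.projectionOnto C₀ hC₀ x).2
  let p : M →ₗ[k] M := p₀.restrictScalars k
  let q := avg ρ l p
  have hqN : ∀ x ∈ N, q x = x := by
    intro x hx
    have h1 : LinearMap.rTensor H p (ρ x) = ρ x := by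
      obtain ⟨y, hy⟩ := hN x hx
      rw [← hy, ← LinearMap.comp_apply, ← LinearMap.rTensor_comp]
      congr 2
      ext z
      exact hp₀ _ z.2
    simp only [q, avg, LinearMap.comp_apply, h1, sigma_rho hρ, ctr_tmul, hl1, one_smul]
  have hqm : ∀ x, q x ∈ N := by
    intro x
    simp only [q, avg, LinearMap.comp_apply]
    generalize ρ x = w
    induction w using TensorProduct.induction_on with
    | zero => simp
    | add x y hx hy => simp only [map_add]; exact add_mem hx hy
    | tmul m g =>
      rw [LinearMap.rTensor_tmul, sigma, rhoHat_tmul, LinearMap.comp_apply]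
      obtain ⟨y, hy⟩ := hN (p m) (hp₁ m)
      rw [← hy]
      generalize (y : (N.restrictScalars k) ⊗[k] H) = y
      induction y using TensorProduct.induction_on with
      | zero => simp
      | add x y hx hy => simp only [map_add]; exact add_mem hx hy
      | tmul m g =>
        simp only [LinearMap.rTensor_tmul, LinearMap.lTensor_tmul, ctr_tmul]
        exact (N.restrictScalars k).smul_mem _ m.2
  let qH : M →ₗ[H] M :=
    { q with map_smul' := fun h m => avg_smul hρ hc l p (fun h m => p₀.map_smul h m) h m }
  refine ⟨LinearMap.ker qH, ?_, ?_⟩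
  · intro φ x hx
    have hx' : q x = 0 := hx
    change q (dact ρ φ x) = 0
    simp only [dact, LinearMap.comp_apply]
    rw [← ctr_rTensor, ← avg_colin hρ l hl p x, show avg ρ l p x = 0 from hx', map_zero, map_zero]
  · constructor
    · rw [Submodule.disjoint_def]
      intro x hx hx'
      rw [← hqN x hx]; exact hx'
    · rw [codisjoint_iff, eq_top_iff]
      intro x _
      rw [Submodule.mem_sup]
      refine ⟨q x, hqm x, x - q x, ?_, by simp⟩
      change q (x - q x) = 0
      rw [map_sub, hqN _ (hqm x), sub_self]

theorem main_aux {Sinv : H →ₗ[k] H} {ρ : M →ₗ[k] M ⊗[k] H} (hρ : IsComod k H ρ)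
    (hc : IsYDCompat k H Sinv ρ) (hn : IsNoetherianRing H) (hss : IsSemisimpleRing H)
    (hcoss : Cosemisimple k H) : IsSemisimpleObj ρ := by
  obtain ⟨l, hl1, hl⟩ := exists_integral hcoss
  let T : Set (Module.End k M) := Set.range (dact ρ) ∪ Set.range (smulMap k H)
  let R := Algebra.adjoin k T
  -- passage between subobjects and `R`-submodules
  let toH : Submodule R M → Submodule H M := fun q =>
    { q with smul_mem' := fun h m hm => adj_stable q (t := smulMap k H h) (Or.inr ⟨h, rfl⟩) hm }
  have hto : ∀ q, IsSubobject ρ (toH q) := fun q =>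
    (isSubobject_iff ρ _).2 fun φ m hm => adj_stable q (Or.inl ⟨φ, rfl⟩) hm
  have hto' : ∀ p : Submodule H M, (∀ φ : H →ₗ[k] k, ∀ x ∈ p, dact ρ φ x ∈ p) →
      ∃ q, toH q = p := by
    intro p hp
    refine ⟨adjSub T (p.restrictScalars k) ?_, rfl⟩
    rintro _ (⟨φ, rfl⟩ | ⟨h, rfl⟩) m hm
    · exact hp φ m hm
    · exact p.smul_mem h hm
  have hle : ∀ q q', toH q ≤ toH q' ↔ q ≤ q' := fun q q' => Iff.rfl
  have hinj : Function.Injective toH := fun q q' h =>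
    le_antisymm ((hle _ _).1 h.le) ((hle _ _).1 h.ge)
  have hbot : toH ⊥ = ⊥ := rfl
  have htop : toH ⊤ = ⊤ := rfl
  have hsup : ∀ {α : Type} (f : α → Submodule R M), toH (⨆ i, f i) = ⨆ i, toH (f i) := by
    intro α f
    apply le_antisymm
    · obtain ⟨q, hq⟩ := hto' (⨆ i, toH (f i)) (by
        intro φ x hx
        induction hx using Submodule.iSup_induction' with
        | mem i x hx =>
          exact Submodule.mem_iSup_of_mem i ((isSubobject_iff ρ _).1 (hto (f i)) φ x hx)
        | zero => simp
        | add x y _ _ hx hy => rw [map_add]; exact add_mem hx hy)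
      rw [← hq, hle]
      refine iSup_le fun i => ?_
      rw [← hle, hq]
      exact le_iSup (fun i => toH (f i)) i
    · exact iSup_le fun i => (hle _ _).2 (le_iSup f i)
  have hsemi : IsSemisimpleModule R M := by
    refine (isSemisimpleModule_iff R M).2 ⟨fun q => ?_⟩
    obtain ⟨C, hC, hcompl⟩ := exists_compl hρ hc hss l hl1 hl (toH q) (hto q)
    obtain ⟨c, rfl⟩ := hto' C hC
    refine ⟨c, ?_, ?_⟩
    · rw [Submodule.disjoint_def]
      exact fun x => (Submodule.disjoint_def.1 hcompl.1) x
    · rw [codisjoint_iff_le_sup]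
      intro x _
      have : x ∈ toH q ⊔ toH c := by rw [hcompl.sup_eq_top]; trivial
      obtain ⟨a, ha, b, hb, rfl⟩ := Submodule.mem_sup.1 this
      exact Submodule.add_mem_sup ha hb
  obtain ⟨s, hind, hs, hsim⟩ := IsSemisimpleModule.exists_sSupIndep_sSup_simples_eq_top R M
  refine ⟨s, fun i => toH i.1, fun i => ?_, ?_, ?_⟩
  · have := hsim i.1 i.2
    have hat : IsAtom i.1 := isSimpleModule_iff_isAtom.1 this
    have hne : toH i.1 ≠ ⊥ := fun h => hat.1 (hinj (h.trans hbot.symm))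
    refine ⟨⟨hto _, hne, fun q hq hqi => ?_⟩, ?_⟩
    · obtain ⟨q, rfl⟩ := hto' q ((isSubobject_iff ρ _).1 hq)
      rcases hat.le_iff.1 ((hle _ _).1 hqi) with h | h
      · left; rw [h]; exact hbot
      · right; rw [h]
    · obtain ⟨m, hm, hm0⟩ := Submodule.exists_mem_ne_zero_of_ne_bot hne
      obtain ⟨p, hpfg, hmp, hp⟩ := exists_fg_subobject hρ hc hn m
      obtain ⟨q, rfl⟩ := hto' p hp
      have hiq : i.1 ≤ q := by
        rcases hat.le_iff.1 (inf_le_left : i.1 ⊓ q ≤ i.1) with h | h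
        · exfalso
          apply hm0
          have : m ∈ i.1 ⊓ q := ⟨hm, hmp⟩
          rw [h] at this
          exact this
        · exact inf_eq_left.1 h
      have : Module.Finite H (toH q) := Module.Finite.iff_fg.2 hpfg
      have hNo : IsNoetherian H (toH q) := isNoetherian_of_isNoetherianRing_of_finite H _
      exact isNoetherian_submodule.1 hNo _ ((hle _ _).2 hiq)
  · have hind' := (sSupIndep_iff s).1 hind
    intro i
    have h2 := hind' i
    have h3 : (⨆ j, ⨆ (_ : j ≠ i), toH j.1) ≤ toH (⨆ j, ⨆ (_ : j ≠ i), j.1) :=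
      iSup₂_le fun j hj => (hle _ _).2 (le_iSup₂ (f := fun (j : s) (_ : j ≠ i) => j.1) j hj)
    refine Disjoint.mono_right h3 ?_
    rw [Submodule.disjoint_def]
    exact fun x => (Submodule.disjoint_def.1 h2) x
  · rw [← hsup, ← sSup_eq_iSup', hs, htop]

end Helpers2

/-- Corollary 3.4. Let `k` be a field and `H` a commutative Hopf
algebra over `k` with bijective antipode which is noetherian, semisimple and
cosemisimple. Then every left-right Yetter-Drinfeld module over `H` is a direct sum,
in the category of Yetter-Drinfeld modules, of a family of simple subobjects which
are finitely generated as `H`-modules; hence the category of Yetter-Drinfeld modules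
over `H` is semisimple. -/
theorem semisimplicity_of_YetterDrinfeld_modules
    (k H : Type) [Field k] [CommRing H] [HopfAlgebra k H]
    (Sinv : H →ₗ[k] H)
    (hS1 : ∀ h : H, Sinv (HopfAlgebra.antipode (R := k) (A := H) h) = h)
    (hS2 : ∀ h : H, HopfAlgebra.antipode (R := k) (A := H) (Sinv h) = h)
    (hnoeth : IsNoetherianRing H)
    (hss : IsSemisimpleRing H)
    (hcoss : Cosemisimple k H) :
    ∀ A : YDCat k H Sinv, IsSemisimpleObj A.ρ := by
  exact fun A => main_aux A.comod A.compat hnoeth hss hcoss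
end YDPaper
end
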